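/- In the algebra A of the context, define W_1 = [x1, x2]_R and, for k ≥ 2, W_k = [[W_{k−1}, x1]_R, x2]_R (the left-normed alternating bracket [[…[[x1,x2]_R, x1]_R, x2]_R …]_R with 2k−1 brackets, using the graded R-bracket of the context). Then for all k ≥ 1: W_k = 2^{k−1} · (p12·p21)^{k(k−1)/2} · (p12^{k}·(x1 x2)^{k} − p21^{k}·(x2 x1)^{k}). -/

import Mathlib

/-- The relations `x1² = 0`, `x2² = 0` in the free algebra `F⟨x1,x2⟩`. -/
inductive sqRel (F : Type*) [Field F] :
    FreeAlgebra F (Fin 2) → FreeAlgebra F (Fin 2) → Prop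
  | sq1 : sqRel F (FreeAlgebra.ι F 0 * FreeAlgebra.ι F 0) 0
  | sq2 : sqRel F (FreeAlgebra.ι F 1 * FreeAlgebra.ι F 1) 0

/-- The algebra `A = F⟨x1,x2⟩/(x1², x2²)`. -/
abbrev QAlg (F : Type*) [Field F] := RingQuot (sqRel F)

/-- The generator `x1` of `A`. -/
noncomputable def X1 (F : Type*) [Field F] : QAlg F :=
  RingQuot.mkAlgHom F (sqRel F) (FreeAlgebra.ι F 0)

/-- The generator `x2` of `A`. -/
noncomputable def X2 (F : Type*) [Field F] : QAlg F :=
  RingQuot.mkAlgHom F (sqRel F) (FreeAlgebra.ι F 1)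

/-- The bicharacter `p((a,b),(c,d)) = (−1)^{ac}·p12^{ad}·p21^{bc}·(−1)^{bd}` on `ℤ²`. -/
noncomputable def bichar {F : Type*} [Field F] (p12 p21 : F) (d e : ℤ × ℤ) : F :=
  (-1 : F) ^ (d.1 * e.1) * p12 ^ (d.1 * e.2) * p21 ^ (d.2 * e.1) * (-1 : F) ^ (d.2 * e.2)

/-- The graded R-bracket on pairs (degree, element): `[u,v]_R = p_{u,v}·uv − p_{v,u}·vu`. -/
noncomputable def brR {F : Type*} [Field F] (p12 p21 : F)
    (u v : (ℤ × ℤ) × QAlg F) : (ℤ × ℤ) × QAlg F :=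
  (u.1 + v.1, bichar p12 p21 u.1 v.1 • (u.2 * v.2) - bichar p12 p21 v.1 u.1 • (v.2 * u.2))

/-- The graded L-bracket on pairs (degree, element): `[u,v]_L = p_{v,u}·uv − p_{u,v}·vu`. -/
noncomputable def brL {F : Type*} [Field F] (p12 p21 : F)
    (u v : (ℤ × ℤ) × QAlg F) : (ℤ × ℤ) × QAlg F :=
  (u.1 + v.1, bichar p12 p21 v.1 u.1 • (u.2 * v.2) - bichar p12 p21 u.1 v.1 • (v.2 * u.2))

/-- `x1` together with its degree `(1,0)`. -/
noncomputable def x1P (F : Type*) [Field F] : (ℤ × ℤ) × QAlg F := ((1, 0), X1 F)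

/-- `x2` together with its degree `(0,1)`. -/
noncomputable def x2P (F : Type*) [Field F] : (ℤ × ℤ) × QAlg F := ((0, 1), X2 F)

/-- `W_{k+1}` (indexed from `0`): `altR 0 = [x1,x2]_R` and
`altR k = [[altR (k−1), x1]_R, x2]_R`, i.e. the left-normed alternating bracket
`[[…[[x1,x2]_R, x1]_R, x2]_R …]_R` with `2k+1` brackets (computed with its degree). -/
noncomputable def altR {F : Type*} [Field F] (p12 p21 : F) : ℕ → (ℤ × ℤ) × QAlg F
  | 0 => brR p12 p21 (x1P F) (x2P F)
  | k + 1 => brR p12 p21 (brR p12 p21 (altR p12 p21 k) (x1P F)) (x2P F)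

theorem aux_mul_pow {A : Type*} [Ring A] (a b : A) (n : ℕ) :
    a * (b * a) ^ n = (a * b) ^ n * a := by
  induction n with
  | zero => simp
  | succ n ih => rw [pow_succ, ← mul_assoc, ih, pow_succ]; simp only [mul_assoc]

theorem aux_step1 {F A : Type*} [Field F] [Ring A] [Algebra F A] (a b : A)
    (ha : a * a = 0) (c p q s : F) (n : ℕ) :
    (s * q) • ((c • (p • (a * b) ^ (n + 1) - q • (b * a) ^ (n + 1))) * a)
      - (s * p) • (a * (c • (p • (a * b) ^ (n + 1) - q • (b * a) ^ (n + 1))))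
      = (2 * c * s * (p * q)) • ((a * b) ^ (n + 1) * a) := by
  have h1 : (b * a) ^ (n + 1) * a = 0 := by
    rw [pow_succ, mul_assoc, mul_assoc, ha]; simp
  have h2 : a * (a * b) ^ (n + 1) = 0 := by
    rw [pow_succ', ← mul_assoc, ← mul_assoc, ha]; simp
  simp only [smul_mul_assoc, mul_smul_comm, sub_mul, mul_sub, h1, h2, aux_mul_pow, smul_zero,
    sub_zero, zero_sub]
  module

theorem aux_step2 {F A : Type*} [Field F] [Ring A] [Algebra F A] (a b : A)
    (c p q s : F) (n : ℕ) :
    (s * p) • ((c • ((a * b) ^ n * a)) * b) - (s * q) • (b * (c • ((a * b) ^ n * a)))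
      = (s * c) • (p • (a * b) ^ (n + 1) - q • (b * a) ^ (n + 1)) := by
  have h1 : (a * b) ^ n * a * b = (a * b) ^ (n + 1) := by rw [pow_succ, mul_assoc]
  have h2 : b * ((a * b) ^ n * a) = (b * a) ^ (n + 1) := by
    rw [← mul_assoc, aux_mul_pow, pow_succ, mul_assoc]
  simp only [smul_mul_assoc, mul_smul_comm, h1, h2]
  module

theorem aux_X1 (F : Type*) [Field F] : X1 F * X1 F = 0 := by
  have := RingQuot.mkAlgHom_rel F (sqRel.sq1 (F := F))
  simpa [X1] using this

theorem aux_main {F : Type*} [Field F] (p12 p21 : F) (n : ℕ) :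
    altR p12 p21 n = ((((n + 1 : ℕ) : ℤ), ((n + 1 : ℕ) : ℤ)),
      ((2 : F) ^ n * (p12 * p21) ^ ((n + 1) * n / 2)) •
        (p12 ^ (n + 1) • ((X1 F * X2 F) ^ (n + 1)) - p21 ^ (n + 1) • ((X2 F * X1 F) ^ (n + 1)))) := by
  induction n with
  | zero => simp [altR, brR, bichar, x1P, x2P]
  | succ n ih =>
    have e : (n + 1 + 1) * (n + 1) / 2 = (n + 1) * n / 2 + (n + 1) := by
      rw [show (n + 1 + 1) * (n + 1) = (n + 1) * n + (n + 1) * 2 by ring]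
      exact Nat.add_mul_div_right _ _ (by norm_num)
    have hs : (-1 : F) ^ (n + 1) * (-1) ^ (n + 1) = 1 := by
      rw [← mul_pow]; simp
    have b1 : bichar p12 p21 (((n + 1 : ℕ) : ℤ), ((n + 1 : ℕ) : ℤ)) (1, 0)
        = (-1) ^ (n + 1) * p21 ^ (n + 1) := by
      simp only [bichar, mul_one, mul_zero, zpow_zero, zpow_natCast]
    have b2 : bichar p12 p21 (1, 0) (((n + 1 : ℕ) : ℤ), ((n + 1 : ℕ) : ℤ))
        = (-1) ^ (n + 1) * p12 ^ (n + 1) := by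
      simp only [bichar, one_mul, mul_one, zero_mul, zpow_zero, zpow_natCast]
    have b3 : bichar p12 p21 ((((n + 1 : ℕ) : ℤ), ((n + 1 : ℕ) : ℤ)) + (1, 0)) (0, 1)
        = (-1) ^ (n + 1) * p12 ^ (n + 1 + 1) := by
      have : ((n + 1 : ℕ) : ℤ) + 1 = ((n + 1 + 1 : ℕ) : ℤ) := by push_cast; ring
      simp only [bichar, Prod.mk_add_mk, this, add_zero, mul_one, mul_zero, one_mul, zpow_zero,
        zpow_natCast]
      ring
    have b4 : bichar p12 p21 (0, 1) ((((n + 1 : ℕ) : ℤ), ((n + 1 : ℕ) : ℤ)) + (1, 0))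
        = (-1) ^ (n + 1) * p21 ^ (n + 1 + 1) := by
      have : ((n + 1 : ℕ) : ℤ) + 1 = ((n + 1 + 1 : ℕ) : ℤ) := by push_cast; ring
      simp only [bichar, Prod.mk_add_mk, this, add_zero, zero_mul, one_mul, zpow_zero,
        zpow_natCast]
      ring
    rw [altR, ih]
    simp only [brR, x1P, x2P]
    rw [b1, b2, b3, b4, aux_step1 _ _ (aux_X1 F), aux_step2, e]
    refine Prod.ext (by simp) ?_
    simp only
    congr 1
    rw [pow_add (p12 * p21), mul_pow p12 p21 (n + 1), pow_succ 2 n]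
    linear_combination (2 * 2 ^ n * (p12 * p21) ^ ((n + 1) * n / 2) *
      (p12 ^ (n + 1) * p21 ^ (n + 1))) * hs

theorem stmt13 {F : Type*} [Field F] [CharZero F] (p12 p21 : F)
    (h12 : p12 ≠ 0) (h21 : p21 ≠ 0) (k : ℕ) (hk : 1 ≤ k) :
    (altR p12 p21 (k - 1)).2 =
      ((2 : F) ^ (k - 1) * (p12 * p21) ^ (k * (k - 1) / 2)) •
        (p12 ^ k • ((X1 F * X2 F) ^ k) - p21 ^ k • ((X2 F * X1 F) ^ k)) := by

  obtain ⟨n, rfl⟩ : ∃ n, k = n + 1 := ⟨k - 1, by omega⟩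
  rw [Nat.add_sub_cancel, aux_main]
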